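/- arXiv:2406.06755 — 8 statements merged into one kernel-verified Lean document; each statement's English description precedes it below -/
import Mathlib

section
/- Let γ > 0, let m ≥ 1 be an integer, and let n_1,…,n_m and ε_1,…,ε_m be strictly positive reals. Suppose there is an index j* ∈ {1,…,m} such that min( n_{j*}² ε_{j*}², n_{j*}^{(2γ+4)/(2γ+2)} ε_{j*}^{2/(2γ+2)}, n_{j*}^{(2γ+2)/(2γ+1)} ) ≥ Σ_{j ≠ j*} n_j² ε_j². Set D* := min( (n_{j*}² ε_{j*}²)^{1/(2γ+2)}, n_{j*}^{1/(2γ+1)} ). If D > 0 solves D^{2γ+2} = Σ_{j=1}^m min(n_j² ε_j², n_j D), then D* ≤ D ≤ 2^{1/(2γ+1)} · D*. -/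
open scoped BigOperators

/-- For positive reals `n`, `ε` and `p`, the quantity `n^((p+2)/p) ε^(2/p)` factors as
`n (n² ε²)^(1/p)`. -/
theorem rpow_mul_rpow_eq_mul_sq_mul_sq_rpow {n ε p : ℝ} (hn : 0 < n) (hε : 0 < ε) (hp : 0 < p) :
    n ^ ((p + 2) / p) * ε ^ (2 / p) = n * (n ^ 2 * ε ^ 2) ^ (1 / p) := by
  rw [Real.mul_rpow (by positivity) (by positivity), ← Real.rpow_natCast n 2,
    ← Real.rpow_natCast ε 2, ← Real.rpow_mul hn.le, ← Real.rpow_mul hε.le,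
    show (p + 2) / p = 1 + 2 / p by field_simp, Real.rpow_add hn, Real.rpow_one, mul_assoc]
  norm_num [div_eq_mul_inv]

/-- A positive `D` with `min a (N D) ≤ D^(q+1)` is at least `min (a^(1/(q+1))) (N^(1/q))`. -/
theorem min_rpow_le_of_min_le_rpow {a N q D : ℝ} (ha : 0 ≤ a) (hN : 0 ≤ N) (hq : 0 < q)
    (hD : 0 < D) (h : min a (N * D) ≤ D ^ (q + 1)) :
    min (a ^ (1 / (q + 1))) (N ^ (1 / q)) ≤ D := by
  rw [one_div, one_div, min_le_iff, Real.rpow_inv_le_iff_of_pos ha hD.le (by positivity),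
    Real.rpow_inv_le_iff_of_pos hN hD.le hq]
  refine (min_le_iff.mp h).imp_right fun h => ?_
  rw [Real.rpow_add_one hD.ne'] at h
  exact le_of_mul_le_mul_right h hD

/-- A positive `D` with `D^(q+1) ≤ 2 min a (N D)` is at most
`2^(1/q) min (a^(1/(q+1))) (N^(1/q))`. -/
theorem le_two_rpow_mul_min_rpow {a N q D : ℝ} (ha : 0 ≤ a) (hN : 0 ≤ N) (hq : 0 < q)
    (hD : 0 < D) (h₁ : D ^ (q + 1) ≤ 2 * a) (h₂ : D ^ (q + 1) ≤ 2 * (N * D)) :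
    D ≤ 2 ^ (1 / q) * min (a ^ (1 / (q + 1))) (N ^ (1 / q)) := by
  rw [mul_min_of_nonneg _ _ (by positivity), le_min_iff]
  constructor
  · calc D ≤ (2 * a) ^ (1 / (q + 1)) := by
          rwa [one_div, Real.le_rpow_inv_iff_of_pos hD.le (by positivity) (by positivity)]
      _ = 2 ^ (1 / (q + 1)) * a ^ (1 / (q + 1)) := Real.mul_rpow (by norm_num) ha
      _ ≤ 2 ^ (1 / q) * a ^ (1 / (q + 1)) := by
          gcongr
          · norm_num
          · linarith
  · rw [← Real.mul_rpow (by norm_num) hN, one_div,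
      Real.le_rpow_inv_iff_of_pos hD.le (by positivity) hq]
    rw [Real.rpow_add_one hD.ne', ← mul_assoc] at h₂
    exact le_of_mul_le_mul_right h₂ hD

/-- In the "dominant budget" regime, where one server `j*` satisfies
`min(n_{j*}² ε_{j*}², n_{j*}^{(2γ+4)/(2γ+2)} ε_{j*}^{2/(2γ+2)}, n_{j*}^{(2γ+2)/(2γ+1)})
  ≥ ∑_{j ≠ j*} n_j² ε_j²`,
any positive solution `D` of `D^(2γ+2) = ∑_j min(n_j² ε_j², n_j D)` satisfies
`D* ≤ D ≤ 2^{1/(2γ+1)} D*` with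
`D* = min((n_{j*}² ε_{j*}²)^{1/(2γ+2)}, n_{j*}^{1/(2γ+1)})`. -/
theorem dominant_budget_resolution_bounds
    (γ : ℝ) (hγ : 0 < γ) (m : ℕ) (hm : 1 ≤ m)
    (n ε : Fin m → ℝ) (hn : ∀ j, 0 < n j) (hε : ∀ j, 0 < ε j)
    (jstar : Fin m)
    (hdom : (∑ j ∈ Finset.univ.erase jstar, (n j) ^ 2 * (ε j) ^ 2) ≤
      min ((n jstar) ^ 2 * (ε jstar) ^ 2)
        (min ((n jstar) ^ ((2 * γ + 4) / (2 * γ + 2)) *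
              (ε jstar) ^ (2 / (2 * γ + 2)))
          ((n jstar) ^ ((2 * γ + 2) / (2 * γ + 1)))))
    (D : ℝ) (hD : 0 < D)
    (hDeq : D ^ (2 * γ + 2) = ∑ j, min ((n j) ^ 2 * (ε j) ^ 2) (n j * D)) :
    min (((n jstar) ^ 2 * (ε jstar) ^ 2) ^ (1 / (2 * γ + 2)))
        ((n jstar) ^ (1 / (2 * γ + 1))) ≤ D ∧
    D ≤ (2 : ℝ) ^ (1 / (2 * γ + 1)) *
        min (((n jstar) ^ 2 * (ε jstar) ^ 2) ^ (1 / (2 * γ + 2)))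
          ((n jstar) ^ (1 / (2 * γ + 1))) := by
  have hN := hn jstar
  have hE := hε jstar
  have hq : 0 < 2 * γ + 1 := by positivity
  have hp : 2 * γ + 2 = (2 * γ + 1) + 1 := by ring
  have hsum := Finset.add_sum_erase Finset.univ
    (fun j => min ((n j) ^ 2 * (ε j) ^ 2) (n j * D)) (Finset.mem_univ jstar)
  have hrest_nonneg : 0 ≤ ∑ j ∈ Finset.univ.erase jstar,
      min ((n j) ^ 2 * (ε j) ^ 2) (n j * D) :=
    Finset.sum_nonneg fun j _ => le_min (by positivity) (mul_pos (hn j) hD).le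
  have hrest_le : ∑ j ∈ Finset.univ.erase jstar, min ((n j) ^ 2 * (ε j) ^ 2) (n j * D) ≤
      ∑ j ∈ Finset.univ.erase jstar, (n j) ^ 2 * (ε j) ^ 2 :=
    Finset.sum_le_sum fun j _ => min_le_left _ _
  have hexp : (2 * γ + 2) / (2 * γ + 1) = 1 + 1 / (2 * γ + 1) := by
    field_simp
    ring
  rw [show 2 * γ + 4 = (2 * γ + 2) + 2 by ring,
    rpow_mul_rpow_eq_mul_sq_mul_sq_rpow hN hE (by positivity), hexp, Real.rpow_add hN,
    Real.rpow_one, ← mul_min_of_nonneg _ _ hN.le, le_min_iff] at hdom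
  obtain ⟨hdom_sq, hdom_res⟩ := hdom
  rw [hp] at hDeq hdom_res ⊢
  have hlower : min (((n jstar) ^ 2 * (ε jstar) ^ 2) ^ (1 / (2 * γ + 1 + 1)))
      ((n jstar) ^ (1 / (2 * γ + 1))) ≤ D :=
    min_rpow_le_of_min_le_rpow (by positivity) hN.le hq hD (by linarith)
  refine ⟨hlower, le_two_rpow_mul_min_rpow (by positivity) hN.le hq hD ?_ ?_⟩
  · linarith [min_le_left ((n jstar) ^ 2 * (ε jstar) ^ 2) (n jstar * D)]
  · linarith [min_le_right ((n jstar) ^ 2 * (ε jstar) ^ 2) (n jstar * D),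
      mul_le_mul_of_nonneg_left hlower hN.le]
end

section
/- Let n ≥ 1 and l₀ ≤ L be integers, let M > 0, τ > 0, and let c_A be a positive integer. For each l with l₀ ≤ l ≤ L and each k with 0 ≤ k ≤ 2^l − 1, let ψ_{lk} : [0,1] → ℝ satisfy |ψ_{lk}(x)| ≤ 2^{l/2} M for all x ∈ [0,1], and suppose that for every x ∈ [0,1] and every level l, the number of indices k with ψ_{lk}(x) ≠ 0 is at most c_A. For data z = ((y_1,x_1),…,(y_n,x_n)) ∈ (ℝ × [0,1])^n define f̂_{lk}(z) := (1/n) Σ_{i=1}^n [y_i]_τ ψ_{lk}(x_i). Then for any two data sets z, z' ∈ (ℝ × [0,1])^n that differ in at most one coordinate pair (y_i, x_i), the Euclidean distance satisfies ( Σ_{l=l₀}^{L} Σ_{k=0}^{2^l−1} ( f̂_{lk}(z) − f̂_{lk}(z') )² )^{1/2} ≤ 4 √(c_A) M τ √(2^L) / n. -/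
open scoped BigOperators Classical

/-- A sum of squares with at most `c` nonzero terms, each of absolute value at most `B`. -/
lemma sum_sq_le_of_card_support_le {ι : Type*} (s : Finset ι) (f : ι → ℝ) (c : ℕ) (B : ℝ)
    (hB : ∀ k ∈ s, |f k| ≤ B) (hc : (s.filter (fun k => f k ≠ 0)).card ≤ c) :
    ∑ k ∈ s, f k ^ 2 ≤ c * B ^ 2 := by
  have hsupp : ∑ k ∈ s.filter (fun k => f k ≠ 0), f k ^ 2 = ∑ k ∈ s, f k ^ 2 := by
    refine Finset.sum_filter_of_ne fun k _ hk h => hk ?_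
    simp [h]
  rw [← hsupp]
  calc ∑ k ∈ s.filter (fun k => f k ≠ 0), f k ^ 2
      ≤ (s.filter (fun k => f k ≠ 0)).card • B ^ 2 := by
        refine Finset.sum_le_card_nsmul _ _ _ fun k hk => ?_
        exact sq_le_sq' (abs_le.1 (hB k (Finset.mem_filter.1 hk).1)).1
          (abs_le.1 (hB k (Finset.mem_filter.1 hk).1)).2
    _ ≤ c * B ^ 2 := by
        rw [nsmul_eq_mul]
        gcongr

lemma sq_clip_le {τ : ℝ} (hτ : 0 ≤ τ) (y : ℝ) : max (-τ) (min τ y) ^ 2 ≤ τ ^ 2 :=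
  sq_le_sq' (le_max_left _ _) (max_le (by linarith) (min_le_left _ _))

lemma sum_Icc_two_pow_le (l₀ L : ℕ) : ∑ l ∈ Finset.Icc l₀ L, (2 : ℝ) ^ l ≤ 2 * 2 ^ L := by
  calc ∑ l ∈ Finset.Icc l₀ L, (2 : ℝ) ^ l
      ≤ ∑ l ∈ Finset.range (L + 1), (2 : ℝ) ^ l := by
        refine Finset.sum_le_sum_of_subset_of_nonneg (fun l hl => ?_) fun _ _ _ => by positivity
        rw [Finset.mem_Icc] at hl
        rw [Finset.mem_range]
        omega
    _ ≤ 2 * 2 ^ L := by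
        rw [geom_sum_eq (by norm_num), pow_succ]
        linarith

/-- Two sums over a finite type that agree off one index differ by the terms at that index. -/
lemma sum_sub_sum_eq_of_eq_off {ι : Type*} [Fintype ι] (f g : ι → ℝ) (i₀ : ι)
    (h : ∀ i, i ≠ i₀ → f i = g i) : ∑ i, f i - ∑ i, g i = f i₀ - g i₀ := by
  rw [← Finset.sum_sub_distrib]
  exact Fintype.sum_eq_single i₀ fun i hi => sub_eq_zero.2 (h i hi)

/-- `L₂`-sensitivity of the vector of clipped empirical wavelet coefficients:
changing at most one data point changes the coefficient vector by at most
`4 √c_A M τ √(2^L) / n` in Euclidean norm. -/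
theorem l2_sensitivity_clipped_wavelet_coefficients
    (n : ℕ) (hn : 1 ≤ n) (l₀ L : ℕ) (hlL : l₀ ≤ L)
    (M τ : ℝ) (hM : 0 < M) (hτ : 0 < τ) (cA : ℕ) (hcA : 0 < cA)
    (ψ : ℕ → ℕ → ℝ → ℝ)
    (hψ_bound : ∀ l, l₀ ≤ l → l ≤ L → ∀ k < 2 ^ l, ∀ x ∈ Set.Icc (0 : ℝ) 1,
      |ψ l k x| ≤ (2 : ℝ) ^ ((l : ℝ) / 2) * M)
    (hψ_overlap : ∀ x ∈ Set.Icc (0 : ℝ) 1, ∀ l, l₀ ≤ l → l ≤ L →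
      ((Finset.range (2 ^ l)).filter (fun k => ψ l k x ≠ 0)).card ≤ cA)
    (z z' : Fin n → ℝ × ℝ)
    (hz : ∀ i, (z i).2 ∈ Set.Icc (0 : ℝ) 1)
    (hz' : ∀ i, (z' i).2 ∈ Set.Icc (0 : ℝ) 1)
    (hneighbor : ∃ i₀ : Fin n, ∀ i, i ≠ i₀ → z i = z' i) :
    Real.sqrt (∑ l ∈ Finset.Icc l₀ L, ∑ k ∈ Finset.range (2 ^ l),
        ((1 / (n : ℝ)) * ∑ i, max (-τ) (min τ (z i).1) * ψ l k (z i).2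
          - (1 / (n : ℝ)) * ∑ i, max (-τ) (min τ (z' i).1) * ψ l k (z' i).2) ^ 2)
      ≤ 4 * Real.sqrt cA * M * τ * Real.sqrt (2 ^ L) / n := by
  obtain ⟨i₀, hi₀⟩ := hneighbor
  have level_energy : ∀ x ∈ Set.Icc (0 : ℝ) 1, ∀ y : ℝ, ∀ l, l₀ ≤ l → l ≤ L →
      ∑ k ∈ Finset.range (2 ^ l), (max (-τ) (min τ y) * ψ l k x) ^ 2
        ≤ τ ^ 2 * (cA * (2 ^ l * M ^ 2)) := by
    intro x hx y l hl hl'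
    have hB := sum_sq_le_of_card_support_le (Finset.range (2 ^ l)) (fun k => ψ l k x) cA
      ((2 : ℝ) ^ ((l : ℝ) / 2) * M)
      (fun k hk => hψ_bound l hl hl' k (Finset.mem_range.1 hk) x hx)
      (hψ_overlap x hx l hl hl')
    have hpow : ((2 : ℝ) ^ ((l : ℝ) / 2)) ^ 2 = 2 ^ l := by
      rw [← Real.rpow_natCast, ← Real.rpow_mul (by norm_num), ← Real.rpow_natCast]
      congr 1
      push_cast
      ring
    rw [mul_pow, hpow] at hB
    simp_rw [mul_pow, ← Finset.mul_sum]
    exact mul_le_mul (sq_clip_le hτ.le y) hB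
      (Finset.sum_nonneg fun _ _ => sq_nonneg _) (sq_nonneg τ)
  have level_bound : ∀ l ∈ Finset.Icc l₀ L, ∑ k ∈ Finset.range (2 ^ l),
        ((1 / (n : ℝ)) * ∑ i, max (-τ) (min τ (z i).1) * ψ l k (z i).2
          - (1 / (n : ℝ)) * ∑ i, max (-τ) (min τ (z' i).1) * ψ l k (z' i).2) ^ 2
      ≤ 4 * (1 / (n : ℝ)) ^ 2 * τ ^ 2 * cA * M ^ 2 * 2 ^ l := by
    intro l hl
    obtain ⟨hl, hl'⟩ := Finset.mem_Icc.1 hl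
    calc _ ≤ ∑ k ∈ Finset.range (2 ^ l), 2 * (1 / (n : ℝ)) ^ 2 *
            ((max (-τ) (min τ (z i₀).1) * ψ l k (z i₀).2) ^ 2
              + (max (-τ) (min τ (z' i₀).1) * ψ l k (z' i₀).2) ^ 2) := by
          refine Finset.sum_le_sum fun k _ => ?_
          rw [← mul_sub, sum_sub_sum_eq_of_eq_off _ _ i₀ fun i hi => by rw [hi₀ i hi], mul_pow,
            mul_comm 2, mul_assoc]
          refine mul_le_mul_of_nonneg_left ?_ (sq_nonneg _)
          linarith [sq_nonneg (max (-τ) (min τ (z i₀).1) * ψ l k (z i₀).2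
            + max (-τ) (min τ (z' i₀).1) * ψ l k (z' i₀).2)]
      _ ≤ 2 * (1 / (n : ℝ)) ^ 2 *
            (τ ^ 2 * (cA * (2 ^ l * M ^ 2)) + τ ^ 2 * (cA * (2 ^ l * M ^ 2))) := by
          rw [← Finset.mul_sum, Finset.sum_add_distrib]
          exact mul_le_mul_of_nonneg_left
            (add_le_add (level_energy _ (hz i₀) _ l hl hl') (level_energy _ (hz' i₀) _ l hl hl'))
            (by positivity)
      _ = _ := by ring
  refine Real.sqrt_le_iff.2 ⟨by positivity, (Finset.sum_le_sum level_bound).trans ?_⟩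
  rw [← Finset.mul_sum]
  calc _ ≤ 4 * (1 / (n : ℝ)) ^ 2 * τ ^ 2 * cA * M ^ 2 * (2 * 2 ^ L) :=
        mul_le_mul_of_nonneg_left (sum_Icc_two_pow_le l₀ L) (by positivity)
    _ ≤ 4 * (1 / (n : ℝ)) ^ 2 * τ ^ 2 * cA * M ^ 2 * (4 * 2 ^ L) := by
        gcongr
        norm_num
    _ = _ := by
        have hcA_sqrt : Real.sqrt (cA : ℝ) ^ 2 = cA := Real.sq_sqrt (by positivity)
        have hL_sqrt : Real.sqrt ((2 : ℝ) ^ L) ^ 2 = 2 ^ L := Real.sq_sqrt (by positivity)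
        simp only [div_pow, mul_pow, hcA_sqrt, hL_sqrt]
        ring
end

section
/- Let n ≥ 1 and l₀ ≤ L be integers, let M > 0, τ > 0, x₀ ∈ [0,1], and let c_A be a positive integer. For each l with l₀ ≤ l ≤ L and each k with 0 ≤ k ≤ 2^l − 1, let ψ_{lk} : [0,1] → ℝ satisfy |ψ_{lk}(x)| ≤ 2^{l/2} M for all x ∈ [0,1], and suppose that for every x ∈ [0,1] and every level l, the number of indices k with ψ_{lk}(x) ≠ 0 is at most c_A. For data z = ((y_1,x_1),…,(y_n,x_n)) ∈ (ℝ × [0,1])^n define f̂(x₀ | z) := Σ_{l=l₀}^{L} Σ_{k=0}^{2^l−1} ( (1/n) Σ_{i=1}^n [y_i]_τ ψ_{lk}(x_i) ) ψ_{lk}(x₀). Then for any two data sets z, z' ∈ (ℝ × [0,1])^n that differ in at most one coordinate pair, | f̂(x₀ | z) − f̂(x₀ | z') | ≤ 4 c_A M² τ 2^L / n. -/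
open scoped BigOperators Classical

/-- A sum of products of terms bounded by `B`, at most `c` of them nonzero, is at most `c * B ^ 2`. -/
lemma abs_sum_mul_le_of_card_support_le {ι : Type*} (s : Finset ι) (a b : ι → ℝ) (c : ℕ) (B : ℝ)
    (ha : ∀ k ∈ s, |a k| ≤ B) (hb : ∀ k ∈ s, |b k| ≤ B)
    (hc : (s.filter (fun k => b k ≠ 0)).card ≤ c) :
    |∑ k ∈ s, a k * b k| ≤ c * B ^ 2 := by
  have hsupp : ∑ k ∈ s.filter (fun k => b k ≠ 0), a k * b k = ∑ k ∈ s, a k * b k :=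
    Finset.sum_filter_of_ne fun k _ h => right_ne_zero_of_mul h
  rw [← hsupp]
  calc |∑ k ∈ s.filter (fun k => b k ≠ 0), a k * b k|
      ≤ ∑ k ∈ s.filter (fun k => b k ≠ 0), |a k * b k| := Finset.abs_sum_le_sum_abs _ _
    _ ≤ (s.filter (fun k => b k ≠ 0)).card • B ^ 2 := by
        refine Finset.sum_le_card_nsmul _ _ _ fun k hk => ?_
        have hks := Finset.mem_of_mem_filter k hk
        rw [abs_mul, sq]
        exact mul_le_mul (ha k hks) (hb k hks) (abs_nonneg _) ((abs_nonneg _).trans (ha k hks))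
    _ ≤ c * B ^ 2 := by
        rw [nsmul_eq_mul]
        gcongr

/-- Sums of functions of the data change by at most `2 * C` between neighboring data sets. -/
lemma abs_sum_sub_sum_le_of_neighbor {ι α : Type*} [Fintype ι] (g : α → ℝ) (C : ℝ)
    (z z' : ι → α) (hz : ∀ i, |g (z i)| ≤ C) (hz' : ∀ i, |g (z' i)| ≤ C)
    (i₀ : ι) (h : ∀ i, i ≠ i₀ → z i = z' i) :
    |∑ i, g (z i) - ∑ i, g (z' i)| ≤ 2 * C := by
  rw [← Finset.sum_sub_distrib, Finset.sum_eq_single i₀ (fun i _ hi => by rw [h i hi, sub_self])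
    (fun hi => absurd (Finset.mem_univ _) hi)]
  linarith [abs_sub (g (z i₀)) (g (z' i₀)), hz i₀, hz' i₀]

lemma abs_max_neg_min_le {τ : ℝ} (hτ : 0 ≤ τ) (y : ℝ) : |max (-τ) (min τ y)| ≤ τ :=
  abs_le.2 ⟨le_max_left _ _, max_le (by linarith) (min_le_left _ _)⟩

/-- A linear estimator is the empirical mean of the responses weighted by its kernel at `x₀`. -/
lemma sum_coeff_mul_eq_mean_kernel {n : ℕ} (S : Finset ℕ) (T : ℕ → Finset ℕ)
    (ψ : ℕ → ℕ → ℝ → ℝ) (x₀ : ℝ) (c : ℝ) (w x : Fin n → ℝ) :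
    ∑ l ∈ S, ∑ k ∈ T l, (c * ∑ i, w i * ψ l k (x i)) * ψ l k x₀ =
      c * ∑ i, w i * ∑ l ∈ S, ∑ k ∈ T l, ψ l k (x i) * ψ l k x₀ := by
  simp only [Finset.mul_sum, Finset.sum_mul]
  rw [Finset.sum_comm (s := Finset.univ)]
  refine Finset.sum_congr rfl fun l _ => ?_
  rw [Finset.sum_comm (s := Finset.univ)]
  exact Finset.sum_congr rfl fun k _ => Finset.sum_congr rfl fun i _ => by ring

/-- `L₁`-sensitivity of the local estimator of a function at the point `x₀`:
changing at most one data point changes the estimate at `x₀` by at most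
`4 c_A M² τ 2^L / n`. -/
theorem l1_sensitivity_pointwise_wavelet_estimator
    (n : ℕ) (hn : 1 ≤ n) (l₀ L : ℕ) (hlL : l₀ ≤ L)
    (M τ : ℝ) (hM : 0 < M) (hτ : 0 < τ) (x₀ : ℝ) (hx₀ : x₀ ∈ Set.Icc (0 : ℝ) 1)
    (cA : ℕ) (hcA : 0 < cA)
    (ψ : ℕ → ℕ → ℝ → ℝ)
    (hψ_bound : ∀ l, l₀ ≤ l → l ≤ L → ∀ k < 2 ^ l, ∀ x ∈ Set.Icc (0 : ℝ) 1,
      |ψ l k x| ≤ (2 : ℝ) ^ ((l : ℝ) / 2) * M)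
    (hψ_overlap : ∀ x ∈ Set.Icc (0 : ℝ) 1, ∀ l, l₀ ≤ l → l ≤ L →
      ((Finset.range (2 ^ l)).filter (fun k => ψ l k x ≠ 0)).card ≤ cA)
    (z z' : Fin n → ℝ × ℝ)
    (hz : ∀ i, (z i).2 ∈ Set.Icc (0 : ℝ) 1)
    (hz' : ∀ i, (z' i).2 ∈ Set.Icc (0 : ℝ) 1)
    (hneighbor : ∃ i₀ : Fin n, ∀ i, i ≠ i₀ → z i = z' i) :
    |(∑ l ∈ Finset.Icc l₀ L, ∑ k ∈ Finset.range (2 ^ l),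
        ((1 / (n : ℝ)) * ∑ i, max (-τ) (min τ (z i).1) * ψ l k (z i).2) * ψ l k x₀)
      - (∑ l ∈ Finset.Icc l₀ L, ∑ k ∈ Finset.range (2 ^ l),
        ((1 / (n : ℝ)) * ∑ i, max (-τ) (min τ (z' i).1) * ψ l k (z' i).2) * ψ l k x₀)|
      ≤ 4 * cA * M ^ 2 * τ * 2 ^ L / n := by
  obtain ⟨i₀, h_eq⟩ := hneighbor
  have hn_pos : (0 : ℝ) < n := by exact_mod_cast hn
  set K : ℝ → ℝ := fun x =>
    ∑ l ∈ Finset.Icc l₀ L, ∑ k ∈ Finset.range (2 ^ l), ψ l k x * ψ l k x₀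
  have hK_bound : ∀ x ∈ Set.Icc (0 : ℝ) 1, |K x| ≤ cA * M ^ 2 * (2 * 2 ^ L) := by
    intro x hx
    calc |K x| ≤ ∑ l ∈ Finset.Icc l₀ L, cA * M ^ 2 * (2 : ℝ) ^ l := by
          refine (Finset.abs_sum_le_sum_abs _ _).trans (Finset.sum_le_sum fun l hl => ?_)
          obtain ⟨hl₀, hl₁⟩ := Finset.mem_Icc.1 hl
          have h_level := abs_sum_mul_le_of_card_support_le (Finset.range (2 ^ l))
            (fun k => ψ l k x) (fun k => ψ l k x₀) cA _
            (fun k hk => hψ_bound l hl₀ hl₁ k (Finset.mem_range.1 hk) x hx)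
            (fun k hk => hψ_bound l hl₀ hl₁ k (Finset.mem_range.1 hk) x₀ hx₀)
            (by convert hψ_overlap x₀ hx₀ l hl₀ hl₁)
          have h_sq : ((2 : ℝ) ^ ((l : ℝ) / 2)) ^ 2 = 2 ^ l := by
            rw [← Real.rpow_mul_natCast (by norm_num), Nat.cast_ofNat,
              div_mul_cancel₀ _ (two_ne_zero), Real.rpow_natCast]
          rw [mul_pow, h_sq] at h_level
          exact h_level.trans_eq (by ring)
      _ ≤ cA * M ^ 2 * (2 * 2 ^ L) := by
          rw [← Finset.mul_sum]
          exact mul_le_mul_of_nonneg_left (sum_Icc_two_pow_le l₀ L) (by positivity)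
  have h_term : ∀ p : ℝ × ℝ, p.2 ∈ Set.Icc (0 : ℝ) 1 →
      |max (-τ) (min τ p.1) * K p.2| ≤ τ * (cA * M ^ 2 * (2 * 2 ^ L)) := by
    intro p hp
    rw [abs_mul]
    exact mul_le_mul (abs_max_neg_min_le hτ.le _) (hK_bound _ hp) (abs_nonneg _) hτ.le
  have h_sum := abs_sum_sub_sum_le_of_neighbor
    (fun p : ℝ × ℝ => max (-τ) (min τ p.1) * K p.2) _ z z'
    (fun i => h_term _ (hz i)) (fun i => h_term _ (hz' i)) i₀ h_eq
  rw [sum_coeff_mul_eq_mean_kernel, sum_coeff_mul_eq_mean_kernel, ← mul_sub, abs_mul,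
    abs_of_pos (one_div_pos.2 hn_pos), one_div_mul_eq_div]
  refine div_le_div_of_nonneg_right (h_sum.trans_eq ?_) hn_pos.le
  ring
end

section
/- Let Z be a standard Gaussian random variable, let a ∈ ℝ, and let τ > |a|. Then | E[ min( τ + a, max( −τ + a, Z ) ) ] | ≤ 4 |a| e^{ −(τ − |a|)² / 2 }. -/
open MeasureTheory ProbabilityTheory

lemma hasSubgaussianMGF_id_gaussianReal : HasSubgaussianMGF id 1 (gaussianReal 0 1) where
  integrable_exp_mul t := integrable_exp_mul_gaussianReal t
  mgf_le t := by simp [mgf_id_gaussianReal]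

/-- Moving the centre of the clipping interval from `0` to `a` changes the clipped value by at most
`|a|`, and only where `|z| ≥ τ - |a|`. -/
lemma abs_clip_sub_clip_le {a τ : ℝ} (h : |a| < τ) (z : ℝ) :
    |min (τ + a) (max (-τ + a) z) - min τ (max (-τ) z)|
      ≤ {x : ℝ | τ - |a| ≤ |x|}.indicator (fun _ ↦ |a|) z := by
  simp only [Set.indicator_apply, Set.mem_ofPred_eq]
  grind

lemma integral_clip_gaussianReal (τ : ℝ) (hτ : 0 ≤ τ) :
    ∫ z, min τ (max (-τ) z) ∂(gaussianReal 0 1) = 0 := by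
  have hmap : (gaussianReal 0 1).map (fun x ↦ -x) = gaussianReal 0 1 := by
    simp [gaussianReal_map_neg]
  have key : ∫ z, min τ (max (-τ) z) ∂(gaussianReal 0 1)
      = -∫ z, min τ (max (-τ) z) ∂(gaussianReal 0 1) := by
    conv_lhs => rw [← hmap]
    rw [integral_map (by fun_prop)
      (by fun_prop : Continuous fun z : ℝ ↦ min τ (max (-τ) z)).aestronglyMeasurable,
      ← integral_neg]
    congr with z
    grind
  linarith

lemma integrable_clip (l u : ℝ) (μ : Measure ℝ) [IsFiniteMeasure μ] :
    Integrable (fun z ↦ min u (max l z)) μ := by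
  refine Integrable.of_bound (by fun_prop) (|l| + |u|) (.of_forall fun z ↦ ?_)
  rw [Real.norm_eq_abs]
  grind

lemma measureReal_le_abs_gaussianReal_le {t : ℝ} (ht : 0 ≤ t) :
    (gaussianReal 0 1).real {x | t ≤ |x|} ≤ 2 * Real.exp (-t ^ 2 / 2) := by
  have h₁ := hasSubgaussianMGF_id_gaussianReal.measure_ge_le ht
  have h₂ := hasSubgaussianMGF_id_gaussianReal.neg.measure_ge_le ht
  have hset : {x : ℝ | t ≤ |x|} = {x | t ≤ id x} ∪ {x | t ≤ (-id) x} := by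
    ext x
    simp [le_abs]
  rw [hset]
  refine (measureReal_union_le _ _).trans ?_
  simp only [NNReal.coe_one, mul_one] at h₁ h₂
  linarith

/-- Bound on the absolute expectation of a standard Gaussian clipped to the
asymmetric interval `[-τ + a, τ + a]`, for `τ > |a|`. -/
theorem abs_integral_clipped_gaussian_le
    (a τ : ℝ) (h : |a| < τ) :
    |∫ z, min (τ + a) (max (-τ + a) z) ∂(gaussianReal 0 1)|
      ≤ 4 * |a| * Real.exp (-(τ - |a|) ^ 2 / 2) := by
  have hS : MeasurableSet {x : ℝ | τ - |a| ≤ |x|} := measurableSet_le (by fun_prop) (by fun_prop)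
  have htail := measureReal_le_abs_gaussianReal_le (sub_nonneg.2 h.le)
  calc |∫ z, min (τ + a) (max (-τ + a) z) ∂(gaussianReal 0 1)|
      = |∫ z, (min (τ + a) (max (-τ + a) z) - min τ (max (-τ) z)) ∂(gaussianReal 0 1)| := by
        rw [integral_sub (integrable_clip _ _ _) (integrable_clip _ _ _),
          integral_clip_gaussianReal τ ((abs_nonneg a).trans h.le), sub_zero]
    _ ≤ ∫ z, {x : ℝ | τ - |a| ≤ |x|}.indicator (fun _ ↦ |a|) z ∂(gaussianReal 0 1) :=
        (Real.norm_eq_abs _).symm.trans_le <|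
          norm_integral_le_of_norm_le ((integrable_const _).indicator hS)
            (.of_forall (abs_clip_sub_clip_le h))
    _ = (gaussianReal 0 1).real {x | τ - |a| ≤ |x|} * |a| := by
        rw [integral_indicator_const _ hS, smul_eq_mul]
    _ ≤ 2 * Real.exp (-(τ - |a|) ^ 2 / 2) * |a| := by gcongr
    _ ≤ 4 * |a| * Real.exp (-(τ - |a|) ^ 2 / 2) := by
        have : 0 ≤ |a| * Real.exp (-(τ - |a|) ^ 2 / 2) := by positivity
        linarith
end

section
/- Let P and Q be probability measures on a measurable space with P absolutely continuous with respect to Q, and let ε ≥ 0. If the Radon–Nikodym derivative satisfies e^{−ε} ≤ (dP/dQ)(x) ≤ e^{ε} for Q-almost every x, then KL(P‖Q) ≤ ε (e^{ε} − 1). -/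
open MeasureTheory

/-- On `[e^{-ε}, e^{ε}]` the function `klFun r = r * log r + 1 - r` is at most `ε (e^{ε} - 1)`. -/
lemma klFun_le_of_exp_neg_le_of_le_exp {ε r : ℝ} (hlow : Real.exp (-ε) ≤ r)
    (hupp : r ≤ Real.exp ε) : InformationTheory.klFun r ≤ ε * (Real.exp ε - 1) := by
  have hr : 0 < r := (Real.exp_pos _).trans_le hlow
  have hlog : |Real.log r| ≤ ε :=
    abs_le.mpr ⟨(Real.le_log_iff_exp_le hr).mpr hlow, (Real.log_le_iff_le_exp hr).mpr hupp⟩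
  have hε : 0 ≤ ε := (abs_nonneg _).trans hlog
  have hsum : 2 ≤ Real.exp ε + Real.exp (-ε) := by
    linarith [Real.one_le_cosh ε, Real.cosh_eq ε]
  have hsub : |r - 1| ≤ Real.exp ε - 1 := abs_le.mpr ⟨by linarith, by linarith⟩
  calc InformationTheory.klFun r
    _ = Real.log r * (r - 1) + (Real.log r - (r - 1)) := by
      rw [InformationTheory.klFun_apply]; ring
    _ ≤ Real.log r * (r - 1) := by linarith [Real.log_le_sub_one_of_pos hr]
    _ ≤ |Real.log r| * |r - 1| := (le_abs_self _).trans_eq (abs_mul _ _)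
    _ ≤ ε * (Real.exp ε - 1) := mul_le_mul hlog hsub (abs_nonneg _) hε

/-- If the Radon–Nikodym derivative `dP/dQ` lies in `[e^{-ε}, e^{ε}]`
`Q`-almost everywhere, then the Kullback–Leibler divergence
`KL(P‖Q) = ∫ log(dP/dQ) dP` is at most `ε (e^{ε} - 1)`. -/
theorem kl_le_of_max_divergence_le
    {α : Type*} [MeasurableSpace α] (P Q : Measure α)
    [IsProbabilityMeasure P] [IsProbabilityMeasure Q]
    (hPQ : P ≪ Q) (ε : ℝ) (hε : 0 ≤ ε)
    (hbound : ∀ᵐ x ∂Q,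
      Real.exp (-ε) ≤ (P.rnDeriv Q x).toReal ∧
      (P.rnDeriv Q x).toReal ≤ Real.exp ε) :
    ∫ x, Real.log ((P.rnDeriv Q x).toReal) ∂P ≤ ε * (Real.exp ε - 1) := by
  calc ∫ x, Real.log ((P.rnDeriv Q x).toReal) ∂P
    _ = ∫ x, InformationTheory.klFun (P.rnDeriv Q x).toReal ∂Q := by
      rw [← InformationTheory.toReal_klDiv_eq_integral_klFun hPQ,
        InformationTheory.toReal_klDiv_of_measure_eq hPQ (by simp)]
      rfl
    _ ≤ ∫ _, ε * (Real.exp ε - 1) ∂Q :=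
      integral_mono_of_nonneg
        (ae_of_all _ fun _ => InformationTheory.klFun_nonneg ENNReal.toReal_nonneg)
        (integrable_const _)
        (hbound.mono fun _ hx => klFun_le_of_exp_neg_le_of_le_exp hx.1 hx.2)
    _ = ε * (Real.exp ε - 1) := by simp
end

section
/- Let P and Q be probability measures on a standard Borel measurable space with P absolutely continuous with respect to Q, let ε ≥ 0 and δ ∈ [0,1], and suppose that for every measurable set S one has P(S) ≤ e^{ε} Q(S) + δ and Q(S) ≤ e^{ε} P(S) + δ. Then there exist probability measures P' and Q' on the same space such that TV(P, P') ≤ δ, TV(Q, Q') ≤ δ, P' and Q' are mutually absolutely continuous, and e^{−ε} ≤ (dP'/dQ')(x) ≤ e^{ε} for Q'-almost every x. -/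
open MeasureTheory

/-- Total variation distance between two measures: the supremum of
`|P(A) - Q(A)|` over measurable sets `A`. -/
noncomputable def tvDist {α : Type*} [MeasurableSpace α] (P Q : Measure α) : ℝ :=
  ⨆ s : {s : Set α // MeasurableSet s}, |(P s.1).toReal - (Q s.1).toReal|

open scoped NNReal ENNReal

/-- Truncating `P` at `c • Q` removes at most the excess mass of `P` over `c • Q`. -/
lemma measure_univ_le_inf_smul_add {α : Type*} [MeasurableSpace α] (P Q : Measure α)
    [IsFiniteMeasure P] [IsFiniteMeasure Q] (c : ℝ≥0) (d : ℝ≥0∞)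
    (h : ∀ S, MeasurableSet S → P S ≤ c * Q S + d) :
    P Set.univ ≤ (P ⊓ c • Q) Set.univ + d := by
  obtain ⟨s, hs, hle, hge⟩ := exists_isHahnDecomposition P (c • Q)
  have hinf : P.restrict s + (c • Q).restrict sᶜ ≤ P ⊓ c • Q := by
    refine le_inf ?_ ?_
    · calc _ ≤ P.restrict s + P.restrict sᶜ := by gcongr
        _ = P := Measure.restrict_add_restrict_compl hs
    · calc _ ≤ (c • Q).restrict s + (c • Q).restrict sᶜ := by gcongr
        _ = c • Q := Measure.restrict_add_restrict_compl hs
  calc P Set.univ = P s + P sᶜ := (measure_add_measure_compl hs).symm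
    _ ≤ P s + (c * Q sᶜ + d) := by gcongr; exact h _ hs.compl
    _ = (P.restrict s + (c • Q).restrict sᶜ) Set.univ + d := by
      rw [Measure.add_apply, Measure.restrict_apply_univ, Measure.restrict_apply_univ,
        Measure.coe_nnreal_smul_apply, add_assoc]
    _ ≤ _ := by gcongr

lemma inf_smul_le_smul_inf_smul {α : Type*} [MeasurableSpace α] (P Q : Measure α)
    {c : ℝ≥0} (hc : 1 ≤ c) : P ⊓ c • Q ≤ c • (Q ⊓ c • P) := by
  have hc0 : c ≠ 0 := (zero_lt_one.trans_le hc).ne'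
  have h : c⁻¹ • (P ⊓ c • Q) ≤ Q ⊓ c • P := by
    refine le_inf ?_ ?_
    · calc c⁻¹ • (P ⊓ c • Q) ≤ c⁻¹ • c • Q := by gcongr; exact inf_le_right
        _ = Q := inv_smul_smul₀ hc0 Q
    · calc c⁻¹ • (P ⊓ c • Q) ≤ c⁻¹ • P := by gcongr; exact inf_le_left
        _ ≤ c • P := by gcongr; exact (inv_le_one_of_one_le₀ hc).trans hc
  calc P ⊓ c • Q = c • c⁻¹ • (P ⊓ c • Q) := (smul_inv_smul₀ hc0 _).symm
    _ ≤ _ := by gcongr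

/-- Two comparable subprobability measures can be enlarged to comparable probability measures. -/
lemma exists_isProbabilityMeasure_ge_of_le_smul {α : Type*} [MeasurableSpace α]
    (A B M : Measure α) [IsProbabilityMeasure M] {c : ℝ≥0} (hc : 1 ≤ c)
    (hAB : A ≤ c • B) (hBA : B ≤ c • A)
    (hA : A Set.univ ≤ B Set.univ) (hB : B Set.univ ≤ 1) :
    ∃ A' B' : Measure α, IsProbabilityMeasure A' ∧ IsProbabilityMeasure B' ∧
      A ≤ A' ∧ B ≤ B' ∧ A' ≤ c • B' ∧ B' ≤ c • A' := by
  have le_smul (μ : Measure α) : μ ≤ c • μ := by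
    calc μ = (1 : ℝ≥0) • μ := (one_smul _ μ).symm
      _ ≤ c • μ := by gcongr
  set m : ℝ≥0∞ := 1 - B Set.univ
  set A₁ := A + m • M
  set B' := B + m • M
  have hB'1 : B' Set.univ = 1 := by simp [B', m, add_tsub_cancel_of_le hB]
  have hA₁1 : A₁ Set.univ ≤ 1 := by
    rw [← hB'1]
    simpa [A₁, B'] using by gcongr
  have hA₁B' : A₁ ≤ c • B' := by
    rw [smul_add]
    exact add_le_add hAB (le_smul _)
  have hB'A₁ : B' ≤ c • A₁ := by
    rw [smul_add]
    exact add_le_add hBA (le_smul _)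
  obtain ⟨a, ha⟩ : ∃ a : ℝ≥0, (a : ℝ≥0∞) = A₁ Set.univ :=
    ⟨_, ENNReal.coe_toNNReal (ne_top_of_le_ne_top ENNReal.one_ne_top hA₁1)⟩
  have ha1 : a ≤ 1 := by
    rw [← ha] at hA₁1
    exact_mod_cast hA₁1
  obtain ⟨u, v, -, -, huv, hx⟩ : 1 ∈ segment ℝ≥0 a c := by
    rw [NNReal.segment_eq_Icc (ha1.trans hc)]
    exact ⟨ha1, hc⟩
  have combo (μ : Measure α) : u • μ + v • μ = μ := by rw [← add_smul, huv, one_smul]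
  refine ⟨u • A₁ + v • c • B', B', ⟨?_⟩, ⟨hB'1⟩, ?_, Measure.le_add_right le_rfl, ?_, ?_⟩
  · simp only [Measure.add_apply, Measure.smul_apply, ← ha, hB'1, ENNReal.smul_def, smul_eq_mul,
      mul_one]
    exact_mod_cast hx
  · calc A ≤ A₁ := Measure.le_add_right le_rfl
      _ = u • A₁ + v • A₁ := (combo _).symm
      _ ≤ _ := by gcongr
  · calc _ ≤ u • c • B' + v • c • B' := by gcongr
      _ = c • B' := combo _
  · calc B' = u • B' + v • B' := (combo _).symm
      _ ≤ u • c • A₁ + v • c • c • B' := by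
        gcongr
        exact (le_smul _).trans (le_smul _)
      _ = _ := by rw [smul_add c (u • A₁), smul_comm c u, smul_comm c v]

lemma tvDist_le_of_common_le {α : Type*} [MeasurableSpace α] {R P P' : Measure α}
    [IsProbabilityMeasure P] [IsProbabilityMeasure P'] (hP : R ≤ P) (hP' : R ≤ P') {δ : ℝ}
    (hδ : 1 ≤ R.real Set.univ + δ) : tvDist P P' ≤ δ := by
  have : IsFiniteMeasure R := isFiniteMeasure_of_le P hP
  have key : ∀ (μ ν : Measure α) [IsProbabilityMeasure μ] [IsProbabilityMeasure ν],
      R ≤ μ → R ≤ ν → ∀ s, MeasurableSet s → μ.real s - ν.real s ≤ δ := by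
    intro μ ν _ _ hμ hν s hs
    have h₁ : R.real s ≤ ν.real s := ENNReal.toReal_mono (measure_ne_top ν s) (hν s)
    have h₂ : R.real sᶜ ≤ μ.real sᶜ := ENNReal.toReal_mono (measure_ne_top μ sᶜ) (hμ sᶜ)
    have h₃ := measureReal_add_measureReal_compl (μ := R) hs
    have h₄ := measureReal_add_measureReal_compl (μ := μ) hs
    rw [probReal_univ] at h₄
    linarith
  have : Nonempty {s : Set α // MeasurableSet s} := ⟨⟨∅, .empty⟩⟩
  refine ciSup_le fun ⟨s, hs⟩ ↦ abs_sub_le_iff.2 ⟨key P P' hP hP' s hs, key P' P hP' hP s hs⟩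

lemma rnDeriv_le_of_le_smul {α : Type*} [MeasurableSpace α] {P Q : Measure α}
    [IsFiniteMeasure P] [IsFiniteMeasure Q] {c : ℝ≥0} (h : P ≤ c • Q) :
    ∀ᵐ x ∂Q, P.rnDeriv Q x ≤ c := by
  refine ae_le_of_forall_setLIntegral_le_of_sigmaFinite (P.measurable_rnDeriv Q) fun s hs _ ↦ ?_
  refine (Measure.setLIntegral_rnDeriv_le s).trans ?_
  simpa only [lintegral_const, Measure.restrict_apply_univ,
    Measure.coe_nnreal_smul_apply] using h s

lemma le_rnDeriv_of_le_smul {α : Type*} [MeasurableSpace α] {P Q : Measure α}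
    [IsFiniteMeasure P] [IsFiniteMeasure Q] (hPQ : P ≪ Q) {c : ℝ≥0} (h : Q ≤ c • P) :
    ∀ᵐ x ∂Q, 1 ≤ c * P.rnDeriv Q x := by
  refine ae_le_of_forall_setLIntegral_le_of_sigmaFinite measurable_const fun s hs _ ↦ ?_
  rw [lintegral_const_mul _ (P.measurable_rnDeriv Q), Measure.setLIntegral_rnDeriv hPQ]
  simpa only [lintegral_const, Measure.restrict_apply_univ, one_mul,
    Measure.coe_nnreal_smul_apply] using h s

/-- If the δ-approximate max-divergence between `P` and `Q` is at most `ε` in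
both directions, then `P` and `Q` can each be modified by at most `δ` in total
variation so that the resulting pair has exact max-divergence at most `ε`
in both directions. -/
theorem exists_pure_dp_approximation
    {α : Type*} [MeasurableSpace α] [StandardBorelSpace α]
    (P Q : Measure α) [IsProbabilityMeasure P] [IsProbabilityMeasure Q]
    (hPQ : P ≪ Q) (ε δ : ℝ) (hε : 0 ≤ ε) (hδ0 : 0 ≤ δ) (hδ1 : δ ≤ 1)
    (h1 : ∀ S : Set α, MeasurableSet S →
      (P S).toReal ≤ Real.exp ε * (Q S).toReal + δ)
    (h2 : ∀ S : Set α, MeasurableSet S →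
      (Q S).toReal ≤ Real.exp ε * (P S).toReal + δ) :
    ∃ P' Q' : Measure α, IsProbabilityMeasure P' ∧ IsProbabilityMeasure Q' ∧
      tvDist P P' ≤ δ ∧ tvDist Q Q' ≤ δ ∧ P' ≪ Q' ∧ Q' ≪ P' ∧
      ∀ᵐ x ∂Q', Real.exp (-ε) ≤ (P'.rnDeriv Q' x).toReal ∧
        (P'.rnDeriv Q' x).toReal ≤ Real.exp ε := by
  obtain ⟨c, hcε⟩ : ∃ c : ℝ≥0, (c : ℝ) = Real.exp ε := ⟨⟨_, (Real.exp_pos ε).le⟩, rfl⟩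
  have hc : 1 ≤ c := by
    have := Real.one_le_exp hε
    rw [← hcε] at this
    exact_mod_cast this
  have hc0 : (0 : ℝ) < c := hcε ▸ Real.exp_pos ε
  lift δ to ℝ≥0 using hδ0
  have toENNReal {x y : ℝ≥0∞} (hx : x ≠ ∞) (hy : y ≠ ∞)
      (h : x.toReal ≤ Real.exp ε * y.toReal + δ) : x ≤ c * y + δ := by
    lift x to ℝ≥0 using hx
    lift y to ℝ≥0 using hy
    rw [← hcε] at h
    exact_mod_cast h
  have hP₀ := measure_univ_le_inf_smul_add P Q c δ fun S hS ↦
    toENNReal (measure_ne_top P S) (measure_ne_top Q S) (h1 S hS)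
  have hQ₀ := measure_univ_le_inf_smul_add Q P c δ fun S hS ↦
    toENNReal (measure_ne_top Q S) (measure_ne_top P S) (h2 S hS)
  have hPQ₀ := inf_smul_le_smul_inf_smul P Q hc
  have hQP₀ := inf_smul_le_smul_inf_smul Q P hc
  have hP₀P : P ⊓ c • Q ≤ P := inf_le_left
  have hQ₀Q : Q ⊓ c • P ≤ Q := inf_le_left
  generalize P ⊓ c • Q = P₀ at *
  generalize Q ⊓ c • P = Q₀ at *
  obtain ⟨P', Q', _, _, hP₀P', hQ₀Q', hPQ', hQP'⟩ : ∃ P' Q' : Measure α,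
      IsProbabilityMeasure P' ∧ IsProbabilityMeasure Q' ∧
      P₀ ≤ P' ∧ Q₀ ≤ Q' ∧ P' ≤ c • Q' ∧ Q' ≤ c • P' := by
    rcases le_total (P₀ Set.univ) (Q₀ Set.univ) with h | h
    · exact exists_isProbabilityMeasure_ge_of_le_smul P₀ Q₀ Q hc hPQ₀ hQP₀ h
        ((hQ₀Q _).trans prob_le_one)
    · obtain ⟨Q', P', hQ', hP', hQ, hP, hQP', hPQ'⟩ :=
        exists_isProbabilityMeasure_ge_of_le_smul Q₀ P₀ P hc hQP₀ hPQ₀ h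
          ((hP₀P _).trans prob_le_one)
      exact ⟨P', Q', hP', hQ', hP, hQ, hPQ', hQP'⟩
  have mass {μ R : Measure α} [IsProbabilityMeasure μ] (hR : R ≤ μ)
      (h : μ Set.univ ≤ R Set.univ + δ) : 1 ≤ R.real Set.univ + δ := by
    have : IsFiniteMeasure R := isFiniteMeasure_of_le μ hR
    rw [measure_univ] at h
    have := ENNReal.toReal_mono (by finiteness) h
    rwa [ENNReal.toReal_add (by finiteness) (by finiteness)] at this
  have hP'Q' : P' ≪ Q' := (Measure.absolutelyContinuous_of_le hPQ').trans
    Measure.smul_absolutelyContinuous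
  refine ⟨P', Q', ‹_›, ‹_›, tvDist_le_of_common_le hP₀P hP₀P' (mass hP₀P hP₀),
    tvDist_le_of_common_le hQ₀Q hQ₀Q' (mass hQ₀Q hQ₀), hP'Q',
    (Measure.absolutelyContinuous_of_le hQP').trans Measure.smul_absolutelyContinuous, ?_⟩
  filter_upwards [rnDeriv_le_of_le_smul hPQ', le_rnDeriv_of_le_smul hP'Q' hQP'] with x hle hge
  lift P'.rnDeriv Q' x to ℝ≥0 using ne_top_of_le_ne_top ENNReal.coe_ne_top hle with r
  rw [Real.exp_neg, ← hcε, ENNReal.coe_toReal, inv_le_iff_one_le_mul₀' hc0]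
  exact ⟨by exact_mod_cast hge, by exact_mod_cast hle⟩
end

section
/- Let m ≥ 1, and for each j = 1,…,m let μ_j and ν_j be probability measures on a standard Borel measurable space Ω_j with μ_j absolutely continuous with respect to ν_j. Let S ⊆ {1,…,m}, and let ε_j ≥ 0 and δ_j ∈ [0,1] for j ∈ S. Suppose that for every j ∈ S and every measurable A ⊆ Ω_j one has μ_j(A) ≤ e^{ε_j} ν_j(A) + δ_j and ν_j(A) ≤ e^{ε_j} μ_j(A) + δ_j, and that KL(μ_j‖ν_j) < ∞ for j ∉ S. Then the product measures satisfy TV( ⊗_{j=1}^m μ_j , ⊗_{j=1}^m ν_j ) ≤ √( 2 ( Σ_{j∈S} ε_j (e^{ε_j} − 1) + Σ_{j∉S} KL(μ_j‖ν_j) ) ) + 4 Σ_{j∈S} δ_j. -/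
open MeasureTheory
open scoped BigOperators

/-- Kullback–Leibler divergence `KL(P‖Q) = ∫ log(dP/dQ) dP`. -/
noncomputable def klDivergence {α : Type*} [MeasurableSpace α]
    (P Q : Measure α) : ℝ :=
  ∫ x, Real.log ((P.rnDeriv Q x).toReal) ∂P

lemma Finset.one_sub_sum_le_prod {ι : Type*} (s : Finset ι) {a d : ι → ℝ}
    (ha0 : ∀ i ∈ s, 0 ≤ a i) (ha1 : ∀ i ∈ s, a i ≤ 1) (had : ∀ i ∈ s, 1 - d i ≤ a i) :
    1 - ∑ i ∈ s, d i ≤ ∏ i ∈ s, a i := by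
  classical
  induction s using Finset.induction_on with
  | empty => simp
  | insert i s hi ih =>
    rw [Finset.sum_insert hi, Finset.prod_insert hi]
    simp only [Finset.forall_mem_insert] at ha0 ha1 had
    have h := ih ha0.2 ha1.2 had.2
    have hP : ∏ j ∈ s, a j ≤ 1 := Finset.prod_le_one ha0.2 ha1.2
    nlinarith [mul_nonneg (sub_nonneg.2 ha1.1) (sub_nonneg.2 hP), had.1]

section BhattacharyyaCoefficient

variable {α : Type*} [MeasurableSpace α]

/-- Cauchy–Schwarz for square roots of nonnegative integrable functions. -/
lemma sq_integral_sqrt_mul_le {ρ : Measure α} {f g : α → ℝ}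
    (hf0 : ∀ x, 0 ≤ f x) (hg0 : ∀ x, 0 ≤ g x) (hf : Integrable f ρ) (hg : Integrable g ρ) :
    (∫ x, √(f x * g x) ∂ρ) ^ 2 ≤ (∫ x, f x ∂ρ) * ∫ x, g x ∂ρ := by
  have memLp {h : α → ℝ} (h0 : ∀ x, 0 ≤ h x) (hh : Integrable h ρ) :
      MemLp (fun x ↦ √(h x)) (ENNReal.ofReal 2) ρ := by
    rw [ENNReal.ofReal_ofNat, memLp_two_iff_integrable_sq
      (Real.continuous_sqrt.comp_aestronglyMeasurable hh.aestronglyMeasurable)]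
    simpa only [Real.sq_sqrt (h0 _)] using hh
  have key := integral_mul_le_Lp_mul_Lq_of_nonneg Real.HolderConjugate.two_two
    (ae_of_all ρ fun x ↦ Real.sqrt_nonneg (f x)) (ae_of_all ρ fun x ↦ Real.sqrt_nonneg (g x))
    (memLp hf0 hf) (memLp hg0 hg)
  simp only [Real.rpow_ofNat, Real.sq_sqrt (hf0 _), Real.sq_sqrt (hg0 _),
    ← Real.sqrt_mul (hf0 _), ← Real.sqrt_eq_rpow] at key
  calc (∫ x, √(f x * g x) ∂ρ) ^ 2
      ≤ (√(∫ x, f x ∂ρ) * √(∫ x, g x ∂ρ)) ^ 2 :=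
        pow_le_pow_left₀ (integral_nonneg fun x ↦ Real.sqrt_nonneg _) key 2
    _ = (∫ x, f x ∂ρ) * ∫ x, g x ∂ρ := by
        rw [mul_pow, Real.sq_sqrt (integral_nonneg hf0), Real.sq_sqrt (integral_nonneg hg0)]

/-- A form of Le Cam's inequality: a lower bound on the overlap of two subprobability densities
in terms of their Bhattacharyya coefficient. -/
lemma sub_sqrt_le_integral_min {ρ : Measure α} {f g : α → ℝ} {c K : ℝ}
    (hf0 : ∀ x, 0 ≤ f x) (hg0 : ∀ x, 0 ≤ g x) (hf : Integrable f ρ) (hg : Integrable g ρ)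
    (hf1 : ∫ x, f x ∂ρ ≤ 1) (hg1 : ∫ x, g x ∂ρ ≤ 1)
    (hcf : c ≤ ∫ x, f x ∂ρ) (hcg : c ≤ ∫ x, g x ∂ρ) (hK : 0 ≤ K)
    (hBC : (∫ x, f x ∂ρ) * (∫ x, g x ∂ρ) * Real.exp (-K) ≤ (∫ x, √(f x * g x) ∂ρ) ^ 2) :
    c - √K ≤ ∫ x, min (f x) (g x) ∂ρ := by
  have hmin : Integrable (fun x ↦ min (f x) (g x)) ρ := hf.inf hg
  have hmax : Integrable (fun x ↦ max (f x) (g x)) ρ := hf.sup hg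
  have hsum : (∫ x, min (f x) (g x) ∂ρ) + ∫ x, max (f x) (g x) ∂ρ
      = (∫ x, f x ∂ρ) + ∫ x, g x ∂ρ := by
    rw [← integral_add hmin hmax, ← integral_add hf hg]
    simp only [min_add_max]
  have hCS := sq_integral_sqrt_mul_le (fun x ↦ le_min (hf0 x) (hg0 x))
    (fun x ↦ (hf0 x).trans (le_max_left _ _)) hmin hmax
  simp only [min_mul_max] at hCS
  have hMf : ∫ x, min (f x) (g x) ∂ρ ≤ ∫ x, f x ∂ρ :=
    integral_mono hmin hf fun x ↦ min_le_left _ _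
  have hMg : ∫ x, min (f x) (g x) ∂ρ ≤ ∫ x, g x ∂ρ :=
    integral_mono hmin hg fun x ↦ min_le_right _ _
  have ha : 0 ≤ ∫ x, f x ∂ρ := integral_nonneg hf0
  have hb : 0 ≤ ∫ x, g x ∂ρ := integral_nonneg hg0
  set a := ∫ x, f x ∂ρ
  set b := ∫ x, g x ∂ρ
  set M := ∫ x, min (f x) (g x) ∂ρ
  obtain hcM | hMc := le_total c M
  · linarith [Real.sqrt_nonneg K]
  have hab0 : 0 ≤ a * b := mul_nonneg ha hb
  have hab1 : a * b ≤ 1 := mul_le_one₀ hf1 hb hg1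
  have hmul : (a - M) * (b - M) ≤ K := by
    rw [eq_sub_of_add_eq' hsum] at hCS
    nlinarith [Real.add_one_le_exp (-K)]
  have hsq : (c - M) ^ 2 ≤ K := by
    rw [sq]
    exact (mul_le_mul (by linarith) (by linarith) (by linarith) (by linarith)).trans hmul
  linarith [Real.le_sqrt_of_sq_le hsq]

end BhattacharyyaCoefficient

section Pi

variable {ι : Type*} [Fintype ι] {Ω : ι → Type*} [∀ j, MeasurableSpace (Ω j)]
  {μ ν : ∀ j, Measure (Ω j)}

lemma MeasureTheory.Measure.pi_eq_withDensity_rnDeriv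
    [∀ j, IsFiniteMeasure (μ j)] [∀ j, IsFiniteMeasure (ν j)] (hac : ∀ j, μ j ≪ ν j) :
    Measure.pi μ = (Measure.pi ν).withDensity
      fun x ↦ ENNReal.ofReal (∏ j, ((μ j).rnDeriv (ν j) (x j)).toReal) := by
  refine Measure.pi_eq fun s hs ↦ ?_
  rw [withDensity_apply _ (MeasurableSet.univ_pi hs), Measure.restrict_pi_pi,
    ← ofReal_integral_eq_lintegral_ofReal
      (Integrable.fintype_prod_dep fun j ↦ Measure.integrable_toReal_rnDeriv.restrict)
      (ae_of_all _ fun x ↦ Finset.prod_nonneg fun j _ ↦ ENNReal.toReal_nonneg),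
    integral_fintype_prod_eq_prod (fun j x ↦ ((μ j).rnDeriv (ν j) x).toReal),
    ENNReal.ofReal_prod_of_nonneg fun j _ ↦ integral_nonneg fun _ ↦ ENNReal.toReal_nonneg]
  refine Finset.prod_congr rfl fun j _ ↦ ?_
  rw [Measure.setIntegral_toReal_rnDeriv (hac j), ofReal_measureReal]

lemma MeasureTheory.Measure.pi_real_eq_setIntegral_rnDeriv
    [∀ j, IsFiniteMeasure (μ j)] [∀ j, IsFiniteMeasure (ν j)] (hac : ∀ j, μ j ≪ ν j)
    {A : Set (∀ j, Ω j)} (hA : MeasurableSet A) :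
    (Measure.pi μ).real A
      = ∫ x in A, ∏ j, ((μ j).rnDeriv (ν j) (x j)).toReal ∂(Measure.pi ν) := by
  rw [measureReal_def, Measure.pi_eq_withDensity_rnDeriv hac, withDensity_apply _ hA,
    integral_eq_lintegral_of_nonneg_ae
      (ae_of_all _ fun x ↦ Finset.prod_nonneg fun j _ ↦ ENNReal.toReal_nonneg)
      (Integrable.fintype_prod_dep
        fun j ↦ Measure.integrable_toReal_rnDeriv).aestronglyMeasurable.restrict]

/-- Factorwise lower bounds on masses and Bhattacharyya coefficients of minorants `f j` of
`dμ j / dν j` and `g j` of `1` bound the total variation between the product measures. -/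
lemma abs_pi_real_sub_pi_real_le
    [∀ j, IsProbabilityMeasure (μ j)] [∀ j, IsProbabilityMeasure (ν j)] (hac : ∀ j, μ j ≪ ν j)
    {f g : ∀ j, Ω j → ℝ} {κ d : ι → ℝ}
    (hfm : ∀ j, Measurable (f j)) (hgm : ∀ j, Measurable (g j))
    (hf0 : ∀ j x, 0 ≤ f j x) (hg0 : ∀ j x, 0 ≤ g j x)
    (hfp : ∀ j x, f j x ≤ ((μ j).rnDeriv (ν j) x).toReal) (hg1 : ∀ j x, g j x ≤ 1)
    (hfd : ∀ j, 1 - d j ≤ ∫ x, f j x ∂(ν j)) (hgd : ∀ j, 1 - d j ≤ ∫ x, g j x ∂(ν j))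
    (hκ : ∀ j, 0 ≤ κ j)
    (hBC : ∀ j, (∫ x, f j x ∂(ν j)) * (∫ x, g j x ∂(ν j)) * Real.exp (-κ j)
      ≤ (∫ x, √(f j x * g j x) ∂(ν j)) ^ 2)
    {A : Set (∀ j, Ω j)} (hA : MeasurableSet A) :
    |(Measure.pi μ).real A - (Measure.pi ν).real A| ≤ √(∑ j, κ j) + ∑ j, d j := by
  have hpi (j) : Integrable (fun x ↦ ((μ j).rnDeriv (ν j) x).toReal) (ν j) :=
    Measure.integrable_toReal_rnDeriv
  have hfi (j) : Integrable (f j) (ν j) :=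
    (hpi j).mono' (hfm j).aestronglyMeasurable
      (ae_of_all _ fun x ↦ (abs_of_nonneg (hf0 j x)).trans_le (hfp j x))
  have hgi (j) : Integrable (g j) (ν j) :=
    (integrable_const (1 : ℝ)).mono' (hgm j).aestronglyMeasurable
      (ae_of_all _ fun x ↦ (abs_of_nonneg (hg0 j x)).trans_le (hg1 j x))
  have hf1 (j) : ∫ x, f j x ∂(ν j) ≤ 1 := by
    simpa [Measure.integral_toReal_rnDeriv (hac j)] using integral_mono (hfi j) (hpi j) (hfp j)
  have hg1' (j) : ∫ x, g j x ∂(ν j) ≤ 1 := by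
    simpa using integral_mono (hgi j) (integrable_const (1 : ℝ)) (hg1 j)
  have hf0' (j) : 0 ≤ ∫ x, f j x ∂(ν j) := integral_nonneg (hf0 j)
  have hg0' (j) : 0 ≤ ∫ x, g j x ∂(ν j) := integral_nonneg (hg0 j)
  let P : (∀ j, Ω j) → ℝ := fun x ↦ ∏ j, ((μ j).rnDeriv (ν j) (x j)).toReal
  let F : (∀ j, Ω j) → ℝ := fun x ↦ ∏ j, f j (x j)
  let G : (∀ j, Ω j) → ℝ := fun x ↦ ∏ j, g j (x j)
  have hP : Integrable P (Measure.pi ν) := Integrable.fintype_prod_dep hpi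
  have hF : Integrable F (Measure.pi ν) := Integrable.fintype_prod_dep hfi
  have hG : Integrable G (Measure.pi ν) := Integrable.fintype_prod_dep hgi
  have hF0 (x) : 0 ≤ F x := Finset.prod_nonneg fun j _ ↦ hf0 j _
  have hG0 (x) : 0 ≤ G x := Finset.prod_nonneg fun j _ ↦ hg0 j _
  have hFP (x) : F x ≤ P x := Finset.prod_le_prod (fun j _ ↦ hf0 j _) fun j _ ↦ hfp j _
  have hG1 (x) : G x ≤ 1 := Finset.prod_le_one (fun j _ ↦ hg0 j _) fun j _ ↦ hg1 j _
  have hFint : ∫ x, F x ∂(Measure.pi ν) = ∏ j, ∫ x, f j x ∂(ν j) :=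
    integral_fintype_prod_eq_prod f
  have hGint : ∫ x, G x ∂(Measure.pi ν) = ∏ j, ∫ x, g j x ∂(ν j) :=
    integral_fintype_prod_eq_prod g
  have hFGint : ∫ x, √(F x * G x) ∂(Measure.pi ν) = ∏ j, ∫ x, √(f j x * g j x) ∂(ν j) := by
    rw [← integral_fintype_prod_eq_prod (fun j x ↦ √(f j x * g j x))]
    congr 1 with x
    rw [← Real.sqrt_prod _ fun j _ ↦ mul_nonneg (hf0 j _) (hg0 j _), Finset.prod_mul_distrib]
  have hmin : Integrable (fun x ↦ min (F x) (G x)) (Measure.pi ν) := hF.inf hG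
  have hM : 1 - ∑ j, d j - √(∑ j, κ j) ≤ ∫ x, min (F x) (G x) ∂(Measure.pi ν) := by
    refine sub_sqrt_le_integral_min hF0 hG0 hF hG ?_ ?_ ?_ ?_
      (Finset.sum_nonneg fun j _ ↦ hκ j) ?_
    · exact hFint.trans_le (Finset.prod_le_one (fun j _ ↦ hf0' j) fun j _ ↦ hf1 j)
    · exact hGint.trans_le (Finset.prod_le_one (fun j _ ↦ hg0' j) fun j _ ↦ hg1' j)
    · exact hFint ▸ Finset.one_sub_sum_le_prod _ (fun j _ ↦ hf0' j) (fun j _ ↦ hf1 j)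
        fun j _ ↦ hfd j
    · exact hGint ▸ Finset.one_sub_sum_le_prod _ (fun j _ ↦ hg0' j) (fun j _ ↦ hg1' j)
        fun j _ ↦ hgd j
    · rw [hFint, hGint, hFGint, ← Finset.sum_neg_distrib, Real.exp_sum,
        ← Finset.prod_mul_distrib, ← Finset.prod_mul_distrib, ← Finset.prod_pow]
      exact Finset.prod_le_prod
        (fun j _ ↦ mul_nonneg (mul_nonneg (hf0' j) (hg0' j)) (Real.exp_nonneg _))
        fun j _ ↦ hBC j
  have hμA : (Measure.pi μ).real A = ∫ x in A, P x ∂(Measure.pi ν) :=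
    Measure.pi_real_eq_setIntegral_rnDeriv hac hA
  have hνA : (Measure.pi ν).real A = ∫ x in A, (1 : ℝ) ∂(Measure.pi ν) := by simp
  have hP1 : ∫ x, P x ∂(Measure.pi ν) = 1 := by
    have h := Measure.pi_real_eq_setIntegral_rnDeriv hac MeasurableSet.univ
    rwa [setIntegral_univ, probReal_univ, eq_comm] at h
  have h1 : Integrable (fun _ ↦ (1 : ℝ)) (Measure.pi ν) := integrable_const 1
  have hle {u v : (∀ j, Ω j) → ℝ} (hu : Integrable u (Measure.pi ν))
      (hv : Integrable v (Measure.pi ν)) (hmu : ∀ x, min (F x) (G x) ≤ u x)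
      (hmv : ∀ x, min (F x) (G x) ≤ v x) (hu1 : ∫ x, u x ∂(Measure.pi ν) = 1) :
      (∫ x in A, u x ∂(Measure.pi ν)) - ∫ x in A, v x ∂(Measure.pi ν)
        ≤ √(∑ j, κ j) + ∑ j, d j := by
    have hA₁ : ∫ x in A, min (F x) (G x) ∂(Measure.pi ν) ≤ ∫ x in A, v x ∂(Measure.pi ν) :=
      setIntegral_mono hmin.integrableOn hv.integrableOn hmv
    have hA₂ := setIntegral_le_integral (s := A) (hu.sub hmin)
      (ae_of_all _ fun x ↦ sub_nonneg.2 (hmu x))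
    simp only [Pi.sub_apply] at hA₂
    rw [integral_sub hu.integrableOn hmin.integrableOn, integral_sub hu hmin, hu1] at hA₂
    linarith
  have hmP (x) : min (F x) (G x) ≤ P x := (min_le_left _ _).trans (hFP x)
  have hm1 (x) : min (F x) (G x) ≤ 1 := (min_le_right _ _).trans (hG1 x)
  rw [hμA, hνA, abs_le, neg_le, neg_sub]
  exact ⟨hle h1 hP hm1 hmP (by simp), hle hP h1 hmP hm1 hP1⟩

end Pi

section Factor

variable {α : Type*} [MeasurableSpace α] {μ ν : Measure α}

/-- If `∫ x in A, u x ∂ν ≤ ∫ x in A, v x ∂ν + δ` for every measurable `A`, then truncating `u` at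
`v` removes mass at most `δ`. -/
lemma integral_sub_le_integral_min {u v : α → ℝ} {δ : ℝ} (hum : Measurable u) (hvm : Measurable v)
    (hu : Integrable u ν) (hv : Integrable v ν)
    (h : ∀ A, MeasurableSet A → ∫ x in A, u x ∂ν ≤ (∫ x in A, v x ∂ν) + δ) :
    (∫ x, u x ∂ν) - δ ≤ ∫ x, min (u x) (v x) ∂ν := by
  have hA : MeasurableSet {x | v x < u x} := measurableSet_lt hvm hum
  have hmin : Integrable (fun x ↦ min (u x) (v x)) ν := hu.inf hv
  have h₁ : ∫ x in {x | v x < u x}, min (u x) (v x) ∂ν = ∫ x in {x | v x < u x}, v x ∂ν :=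
    setIntegral_congr_fun hA fun x hx ↦ min_eq_right (le_of_lt hx)
  have h₂ : ∫ x in {x | v x < u x}ᶜ, min (u x) (v x) ∂ν = ∫ x in {x | v x < u x}ᶜ, u x ∂ν :=
    setIntegral_congr_fun hA.compl fun x hx ↦ min_eq_left (not_lt.1 hx)
  rw [← integral_add_compl hA hu, ← integral_add_compl hA hmin, h₁, h₂]
  linarith [h _ hA]

/-- Lower bound on the Bhattacharyya coefficient of two densities within a factor `exp ε`. -/
lemma integral_mul_integral_mul_exp_le {ε : ℝ} {f g : α → ℝ}
    (hf0 : ∀ x, 0 ≤ f x) (hg0 : ∀ x, 0 ≤ g x) (hf : Integrable f ν) (hg : Integrable g ν)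
    (hfg : ∀ x, f x ≤ Real.exp ε * g x) (hgf : ∀ x, g x ≤ Real.exp ε * f x) :
    (∫ x, f x ∂ν) * (∫ x, g x ∂ν) * Real.exp (-(ε ^ 2 / 4)) ≤ (∫ x, √(f x * g x) ∂ν) ^ 2 := by
  have hexp : Real.exp ε = Real.exp (ε / 2) ^ 2 := by rw [← Real.exp_nat_mul]; ring_nf
  have hpos := Real.exp_pos (ε / 2)
  have hsqrt_le {a b : ℝ} (hb : 0 ≤ b) (h : a ≤ Real.exp ε * b) :
      √a ≤ Real.exp (ε / 2) * √b := by
    refine Real.sqrt_le_iff.2 ⟨by positivity, ?_⟩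
    rwa [mul_pow, Real.sq_sqrt hb, ← hexp]
  have hpt (x) : f x + g x ≤ 2 * Real.cosh (ε / 2) * √(f x * g x) := by
    have hst := mul_nonneg (sub_nonneg.2 (hsqrt_le (hg0 x) (hfg x)))
      (sub_nonneg.2 (hsqrt_le (hf0 x) (hgf x)))
    have hinv : Real.exp (ε / 2) * Real.exp (-(ε / 2)) = 1 := by simp [← Real.exp_add]
    rw [Real.cosh_eq, Real.sqrt_mul (hf0 x)]
    refine le_of_mul_le_mul_left ?_ hpos
    have hs := Real.sq_sqrt (hf0 x)
    have ht := Real.sq_sqrt (hg0 x)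
    linear_combination hst - Real.exp (ε / 2) * hs - Real.exp (ε / 2) * ht
      - √(f x) * √(g x) * hinv
  have hsqrt : Integrable (fun x ↦ √(f x * g x)) ν := by
    refine (hf.add hg).mono' (Real.continuous_sqrt.comp_aestronglyMeasurable
      (hf.aestronglyMeasurable.mul hg.aestronglyMeasurable)) (ae_of_all _ fun x ↦ ?_)
    rw [Real.norm_of_nonneg (Real.sqrt_nonneg _)]
    refine Real.sqrt_le_iff.2 ⟨add_nonneg (hf0 x) (hg0 x), ?_⟩
    simp only [Pi.add_apply]
    nlinarith [mul_nonneg (hf0 x) (hg0 x), sq_nonneg (f x), sq_nonneg (g x)]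
  have hint := integral_mono (hf.add hg) (hsqrt.const_mul (2 * Real.cosh (ε / 2))) hpt
  simp only [Pi.add_apply] at hint
  rw [integral_add hf hg, integral_const_mul] at hint
  have ha : 0 ≤ ∫ x, f x ∂ν := integral_nonneg hf0
  have hb : 0 ≤ ∫ x, g x ∂ν := integral_nonneg hg0
  have hcosh : Real.cosh (ε / 2) ^ 2 ≤ Real.exp (ε ^ 2 / 4) := by
    calc Real.cosh (ε / 2) ^ 2 ≤ Real.exp ((ε / 2) ^ 2 / 2) ^ 2 :=
          pow_le_pow_left₀ (Real.cosh_pos _).le (Real.cosh_le_exp_half_sq _) 2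
      _ = Real.exp (ε ^ 2 / 4) := by rw [← Real.exp_nat_mul]; ring_nf
  have hsq := pow_le_pow_left₀ (add_nonneg ha hb) hint 2
  rw [Real.exp_neg, ← div_eq_mul_inv, div_le_iff₀ (Real.exp_pos _)]
  nlinarith [sq_nonneg ((∫ x, f x ∂ν) - ∫ x, g x ∂ν),
    mul_le_mul_of_nonneg_left hcosh (sq_nonneg (∫ x, √(f x * g x) ∂ν))]

variable [IsProbabilityMeasure μ] [IsProbabilityMeasure ν]

lemma klDivergence_nonneg (hac : μ ≪ ν)
    (hKL : Integrable (fun x ↦ Real.log ((μ.rnDeriv ν x).toReal)) μ) :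
    0 ≤ klDivergence μ ν := by
  simpa [klDivergence, llr] using
    InformationTheory.integral_llr_add_sub_measure_univ_nonneg hac hKL

/-- The Bhattacharyya coefficient is at least `exp (-KL / 2)`. -/
lemma exp_neg_klDivergence_le (hac : μ ≪ ν)
    (hKL : Integrable (fun x ↦ Real.log ((μ.rnDeriv ν x).toReal)) μ) :
    Real.exp (-klDivergence μ ν) ≤ (∫ x, √((μ.rnDeriv ν x).toReal) ∂ν) ^ 2 := by
  set p : α → ℝ := fun x ↦ (μ.rnDeriv ν x).toReal with hp
  set K := klDivergence μ ν with hK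
  have hp0 (x) : 0 ≤ p x := ENNReal.toReal_nonneg
  have hpi : Integrable p ν := Measure.integrable_toReal_rnDeriv
  have hp1 : ∫ x, p x ∂ν = 1 := by simp [hp, Measure.integral_toReal_rnDeriv hac]
  have hlog : Integrable (fun x ↦ p x * Real.log (p x)) ν :=
    (integrable_rnDeriv_mul_log_iff hac).2 hKL
  have hlogint : ∫ x, p x * Real.log (p x) ∂ν = K := integral_rnDeriv_mul_log hac
  have hsqrt : Integrable (fun x ↦ √(p x)) ν := by
    refine (hpi.add (integrable_const (1 : ℝ))).mono'
      (Real.continuous_sqrt.comp_aestronglyMeasurable hpi.aestronglyMeasurable)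
      (ae_of_all _ fun x ↦ ?_)
    rw [Real.norm_of_nonneg (Real.sqrt_nonneg _)]
    simp only [Pi.add_apply]
    nlinarith [Real.sq_sqrt (hp0 x), sq_nonneg (√(p x) - 1)]
  have htangent (x) :
      Real.exp (-K / 2) * ((1 + K / 2) * p x - p x * Real.log (p x) / 2) ≤ √(p x) := by
    obtain h0 | hpos := (hp0 x).eq_or_lt
    · simp [← h0]
    have hexp : √(p x) = p x * (Real.exp (-K / 2) * Real.exp (K / 2 - Real.log (p x) / 2)) := by
      rw [← Real.exp_add, Real.sqrt_eq_rpow, Real.rpow_def_of_pos hpos]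
      nth_rewrite 2 [← Real.exp_log hpos]
      rw [← Real.exp_add]
      ring_nf
    rw [hexp]
    have := mul_le_mul_of_nonneg_left (Real.add_one_le_exp (K / 2 - Real.log (p x) / 2))
      (mul_nonneg (hp0 x) (Real.exp_nonneg (-K / 2)))
    linarith
  have hint := integral_mono (((hpi.const_mul (1 + K / 2)).sub (hlog.div_const 2)).const_mul
    (Real.exp (-K / 2))) hsqrt htangent
  simp only [Pi.sub_apply] at hint
  rw [integral_const_mul, integral_sub (hpi.const_mul _) (hlog.div_const 2), integral_const_mul,
    integral_div, hp1, hlogint] at hint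
  calc Real.exp (-K) = Real.exp (-K / 2) ^ 2 := by rw [← Real.exp_nat_mul]; ring_nf
    _ ≤ _ := pow_le_pow_left₀ (Real.exp_nonneg _) (by linarith) 2

end Factor

/-- Two-point total variation bound for product measures: the factors indexed
by `S` satisfy two-sided `(ε_j, δ_j)` approximate max-divergence bounds, the
remaining factors are controlled through their (finite) KL divergences, and
the total variation distance between the products is bounded by
`√(2(∑_{j∈S} ε_j(e^{ε_j}-1) + ∑_{j∉S} KL(μ_j‖ν_j))) + 4 ∑_{j∈S} δ_j`. -/
theorem tv_product_two_point_bound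
    (m : ℕ) (hm : 1 ≤ m) (Ω : Fin m → Type*)
    [∀ j, MeasurableSpace (Ω j)] [∀ j, StandardBorelSpace (Ω j)]
    (μ ν : ∀ j, Measure (Ω j))
    [∀ j, IsProbabilityMeasure (μ j)] [∀ j, IsProbabilityMeasure (ν j)]
    (hac : ∀ j, μ j ≪ ν j)
    (S : Finset (Fin m)) (ε δ : Fin m → ℝ)
    (hε : ∀ j ∈ S, 0 ≤ ε j) (hδ0 : ∀ j ∈ S, 0 ≤ δ j) (hδ1 : ∀ j ∈ S, δ j ≤ 1)
    (hDP₁ : ∀ j ∈ S, ∀ A : Set (Ω j), MeasurableSet A →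
      (μ j A).toReal ≤ Real.exp (ε j) * (ν j A).toReal + δ j)
    (hDP₂ : ∀ j ∈ S, ∀ A : Set (Ω j), MeasurableSet A →
      (ν j A).toReal ≤ Real.exp (ε j) * (μ j A).toReal + δ j)
    (hKL : ∀ j ∉ S,
      Integrable (fun x => Real.log (((μ j).rnDeriv (ν j) x).toReal)) (μ j)) :
    tvDist (Measure.pi μ) (Measure.pi ν)
      ≤ Real.sqrt (2 * (∑ j ∈ S, ε j * (Real.exp (ε j) - 1)
          + ∑ j ∈ Sᶜ, klDivergence (μ j) (ν j)))
        + 4 * ∑ j ∈ S, δ j := by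
  let p : ∀ j, Ω j → ℝ := fun j x ↦ ((μ j).rnDeriv (ν j) x).toReal
  have hp0 (j) (x) : 0 ≤ p j x := ENNReal.toReal_nonneg
  have hpm (j) : Measurable (p j) := (Measure.measurable_rnDeriv _ _).ennreal_toReal
  have hpi (j) : Integrable (p j) (ν j) := Measure.integrable_toReal_rnDeriv
  have hpA (j) (A) (hA : MeasurableSet A) : ∫ x in A, p j x ∂(ν j) = (μ j A).toReal :=
    Measure.setIntegral_toReal_rnDeriv (hac j) A
  have hp1 (j) : ∫ x, p j x ∂(ν j) = 1 := by
    simpa using hpA j Set.univ MeasurableSet.univ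
  have h1i (j) (c : ℝ) : Integrable (fun _ ↦ c) (ν j) := integrable_const c
  let f : ∀ j, Ω j → ℝ := fun j x ↦ if j ∈ S then min (p j x) (Real.exp (ε j)) else p j x
  let g : ∀ j, Ω j → ℝ := fun j x ↦ if j ∈ S then min 1 (Real.exp (ε j) * p j x) else 1
  let κ : Fin m → ℝ := fun j ↦ if j ∈ S then ε j ^ 2 / 4 else klDivergence (μ j) (ν j)
  let d : Fin m → ℝ := fun j ↦ if j ∈ S then δ j else 0
  have hKL0 : ∀ j ∈ Sᶜ, 0 ≤ klDivergence (μ j) (ν j) := fun j hj ↦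
    klDivergence_nonneg (hac j) (hKL j (Finset.mem_compl.1 hj))
  have hfm (j) : Measurable (f j) := by
    by_cases hj : j ∈ S <;> simp only [f, hj, if_true, if_false]
    · exact (hpm j).min measurable_const
    · exact hpm j
  have hgm (j) : Measurable (g j) := by
    by_cases hj : j ∈ S <;> simp only [g, hj, if_true, if_false]
    · exact measurable_const.min ((hpm j).const_mul _)
    · exact measurable_const
  have hf0 (j) (x) : 0 ≤ f j x := by
    by_cases hj : j ∈ S <;> simp only [f, hj, if_true, if_false]
    · exact le_min (hp0 j x) (Real.exp_nonneg _)
    · exact hp0 j x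
  have hg0 (j) (x) : 0 ≤ g j x := by
    by_cases hj : j ∈ S <;> simp only [g, hj, if_true, if_false]
    · exact le_min zero_le_one (mul_nonneg (Real.exp_nonneg _) (hp0 j x))
    · exact zero_le_one
  have hfp (j) (x) : f j x ≤ p j x := by
    by_cases hj : j ∈ S <;> simp [f, hj]
  have hg1 (j) (x) : g j x ≤ 1 := by
    by_cases hj : j ∈ S <;> simp [g, hj]
  have hfd (j) : 1 - d j ≤ ∫ x, f j x ∂(ν j) := by
    by_cases hj : j ∈ S <;> simp only [f, d, hj, if_true, if_false]
    · rw [← hp1 j]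
      refine integral_sub_le_integral_min (hpm j) measurable_const (hpi j) (h1i j _)
        fun A hA ↦ ?_
      rw [hpA j A hA]
      simpa [measureReal_def, mul_comm] using hDP₁ j hj A hA
    · simp [hp1 j]
  have hgd (j) : 1 - d j ≤ ∫ x, g j x ∂(ν j) := by
    by_cases hj : j ∈ S <;> simp only [g, d, hj, if_true, if_false]
    · have h := integral_sub_le_integral_min (δ := δ j) measurable_const
        ((hpm j).const_mul (Real.exp (ε j))) (h1i j 1) ((hpi j).const_mul _) fun A hA ↦ by
          rw [integral_const_mul, hpA j A hA]
          simpa [measureReal_def] using hDP₂ j hj A hA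
      simpa using h
    · simp
  have hκ (j) : 0 ≤ κ j := by
    by_cases hj : j ∈ S <;> simp only [κ, hj, if_true, if_false]
    · positivity
    · exact hKL0 j (Finset.mem_compl.2 hj)
  have hBC (j) : (∫ x, f j x ∂(ν j)) * (∫ x, g j x ∂(ν j)) * Real.exp (-κ j)
      ≤ (∫ x, √(f j x * g j x) ∂(ν j)) ^ 2 := by
    by_cases hj : j ∈ S
    · have hE : 1 ≤ Real.exp (ε j) := Real.one_le_exp (hε j hj)
      have hpE (x) : p j x ≤ Real.exp (ε j) * p j x := le_mul_of_one_le_left (hp0 j x) hE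
      simp only [f, g, κ, hj, if_true]
      refine integral_mul_integral_mul_exp_le
        (fun x ↦ le_min (hp0 j x) (Real.exp_nonneg _))
        (fun x ↦ le_min zero_le_one (mul_nonneg (Real.exp_nonneg _) (hp0 j x)))
        ((hpi j).inf (h1i j _)) ((h1i j 1).inf ((hpi j).const_mul _)) (fun x ↦ ?_) (fun x ↦ ?_)
      · rw [mul_min_of_nonneg _ _ (Real.exp_nonneg _), mul_one]
        exact le_min (min_le_right _ _) ((min_le_left _ _).trans
          ((hpE x).trans (mul_le_mul_of_nonneg_left (hpE x) (Real.exp_nonneg _))))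
      · rw [mul_min_of_nonneg _ _ (Real.exp_nonneg _)]
        exact le_min (min_le_right _ _)
          ((min_le_left _ _).trans (one_le_mul_of_one_le_of_one_le hE hE))
    · simp only [f, g, κ, hj, if_false, mul_one, hp1 j]
      simpa using exp_neg_klDivergence_le (hac j) (hKL j hj)
  have hsumd : ∑ j, d j = ∑ j ∈ S, δ j := by simp [d, Finset.sum_ite_mem]
  have hsumκ : ∑ j, κ j
      = ∑ j ∈ S, ε j ^ 2 / 4 + ∑ j ∈ Sᶜ, klDivergence (μ j) (ν j) := by
    rw [← Finset.sum_add_sum_compl S]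
    exact congrArg₂ _ (Finset.sum_congr rfl fun j hj ↦ if_pos hj)
      (Finset.sum_congr rfl fun j hj ↦ if_neg (Finset.mem_compl.1 hj))
  have hε2 : ∑ j ∈ S, ε j ^ 2 / 4 ≤ ∑ j ∈ S, ε j * (Real.exp (ε j) - 1) :=
    Finset.sum_le_sum fun j hj ↦ by
      nlinarith [mul_le_mul_of_nonneg_left (Real.add_one_le_exp (ε j)) (hε j hj),
        sq_nonneg (ε j)]
  have hε0 : 0 ≤ ∑ j ∈ S, ε j ^ 2 / 4 := Finset.sum_nonneg fun j _ ↦ by positivity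
  have hδ : 0 ≤ ∑ j ∈ S, δ j := Finset.sum_nonneg hδ0
  have : Nonempty {s : Set (∀ j, Ω j) // MeasurableSet s} := ⟨∅, MeasurableSet.empty⟩
  refine ciSup_le fun A ↦
    (abs_pi_real_sub_pi_real_le hac hfm hgm hf0 hg0 hfp hg1 hfd hgd hκ hBC A.2).trans ?_
  rw [hsumd, hsumκ]
  refine add_le_add (Real.sqrt_le_sqrt ?_) (by linarith)
  linarith [Finset.sum_nonneg hKL0]
end

section
/- Let X and Y be integrable real-valued random variables with E[Y] = 0, let ε ≥ 0 and δ ∈ [0,1], and suppose that for every Borel set A ⊆ ℝ one has P(X ∈ A) ≤ e^{ε} P(Y ∈ A) + δ and P(Y ∈ A) ≤ e^{ε} P(X ∈ A) + δ. Then for every M > 0, E[X] ≤ (e^{ε} − 1) E|Y| + 2 M δ + ∫_M^∞ P(X ≥ t) dt + ∫_M^∞ P(Y ≤ −t) dt. -/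
open MeasureTheory

section Layercake

variable {α : Type*} [MeasurableSpace α] {μ : Measure α} [IsFiniteMeasure μ]

theorem MeasureTheory.Integrable.integrableOn_measureReal_le {f : α → ℝ}
    (hf : Integrable f μ) (hf0 : 0 ≤ f) :
    IntegrableOn (fun t => μ.real {a | t ≤ f a}) (Set.Ioi 0) := by
  have hanti : Antitone fun t => μ.real {a | t ≤ f a} := fun s t hst =>
    measureReal_mono fun a ha => hst.trans ha
  refine ⟨hanti.measurable.aestronglyMeasurable, ?_⟩
  rw [hasFiniteIntegral_iff_ofReal (ae_of_all _ fun t => measureReal_nonneg)]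
  simp only [measureReal_def, ENNReal.ofReal_toReal (measure_ne_top μ _)]
  rw [← lintegral_eq_lintegral_meas_le μ (ae_of_all _ hf0) hf.aemeasurable]
  exact (hasFiniteIntegral_iff_ofReal (ae_of_all _ hf0)).1 hf.hasFiniteIntegral

theorem integral_le_mul_integral_add_of_measureReal_le {f g : α → ℝ}
    (hf : Integrable f μ) (hg : Integrable g μ) (hf0 : 0 ≤ f) (hg0 : 0 ≤ g)
    {c δ M : ℝ} (hc : 0 ≤ c) (hM : 0 ≤ M)
    (h : ∀ t, 0 < t → μ.real {a | t ≤ f a} ≤ c * μ.real {a | t ≤ g a} + δ) :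
    ∫ a, f a ∂μ ≤ c * ∫ a, g a ∂μ + M * δ + ∫ t in Set.Ioi M, μ.real {a | t ≤ f a} := by
  have hfi := hf.integrableOn_measureReal_le hf0
  have hgi := hg.integrableOn_measureReal_le hg0
  have hsub : Set.Ioc 0 M ⊆ Set.Ioi (0 : ℝ) := fun t ht => ht.1
  have hgM : IntegrableOn (fun t => c * μ.real {a | t ≤ g a}) (Set.Ioc 0 M) :=
    (hgi.mono_set hsub).const_mul c
  have hδi : IntegrableOn (fun _ : ℝ => δ) (Set.Ioc 0 M) := by simp
  have hle : ∫ t in Set.Ioc 0 M, μ.real {a | t ≤ f a}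
      ≤ ∫ t in Set.Ioc 0 M, (c * μ.real {a | t ≤ g a} + δ) :=
    setIntegral_mono_on (hfi.mono_set hsub) (hgM.add hδi) measurableSet_Ioc
      fun t ht => h t ht.1
  rw [integral_add hgM hδi, integral_const_mul, setIntegral_const, Real.volume_real_Ioc_of_le hM,
    sub_zero, smul_eq_mul] at hle
  have hg_le : ∫ t in Set.Ioc 0 M, μ.real {a | t ≤ g a} ≤ ∫ a, g a ∂μ := by
    rw [hg.integral_eq_integral_meas_le (ae_of_all _ hg0)]
    exact setIntegral_mono_set hgi (ae_of_all _ fun t => measureReal_nonneg)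
      hsub.eventuallyLE
  have hsplit : ∫ a, f a ∂μ = (∫ t in Set.Ioc 0 M, μ.real {a | t ≤ f a})
      + ∫ t in Set.Ioi M, μ.real {a | t ≤ f a} := by
    rw [hf.integral_eq_integral_meas_le (ae_of_all _ hf0), ← Set.Ioc_union_Ioi_eq_Ioi hM,
      setIntegral_union (Set.Ioc_disjoint_Ioi le_rfl) measurableSet_Ioi (hfi.mono_set hsub)
        (hfi.mono_set (Set.Ioi_subset_Ioi hM))]
  linarith [mul_le_mul_of_nonneg_left hg_le hc]

end Layercake

/-- Core inequality of the score-attack data-processing argument: if the laws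
of `X` and `Y` are `(ε, δ)`-close in the differential-privacy sense and
`E[Y] = 0`, then for every `M > 0`,
`E[X] ≤ (e^ε - 1) E|Y| + 2Mδ + ∫_M^∞ P(X ≥ t) dt + ∫_M^∞ P(Y ≤ -t) dt`. -/
theorem score_attack_expectation_bound
    {Ω : Type*} [MeasurableSpace Ω] (μ : Measure Ω) [IsProbabilityMeasure μ]
    (X Y : Ω → ℝ) (hXm : Measurable X) (hYm : Measurable Y)
    (hX : Integrable X μ) (hY : Integrable Y μ)
    (hEY : ∫ ω, Y ω ∂μ = 0)
    (ε δ : ℝ) (hε : 0 ≤ ε) (hδ0 : 0 ≤ δ) (hδ1 : δ ≤ 1)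
    (hDP₁ : ∀ A : Set ℝ, MeasurableSet A →
      (μ (X ⁻¹' A)).toReal ≤ Real.exp ε * (μ (Y ⁻¹' A)).toReal + δ)
    (hDP₂ : ∀ A : Set ℝ, MeasurableSet A →
      (μ (Y ⁻¹' A)).toReal ≤ Real.exp ε * (μ (X ⁻¹' A)).toReal + δ) :
    ∀ M : ℝ, 0 < M →
      ∫ ω, X ω ∂μ
        ≤ (Real.exp ε - 1) * ∫ ω, |Y ω| ∂μ + 2 * M * δ
          + (∫ t in Set.Ioi M, (μ {ω | t ≤ X ω}).toReal)
          + (∫ t in Set.Ioi M, (μ {ω | Y ω ≤ -t}).toReal) := by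
  intro M hM
  have hpos (Z : Ω → ℝ) {t : ℝ} (ht : 0 < t) :
      {ω | t ≤ max (Z ω) 0} = Z ⁻¹' Set.Ici t := by
    ext ω
    simp [ht.not_ge]
  have hneg (Z : Ω → ℝ) {t : ℝ} (ht : 0 < t) :
      {ω | t ≤ max (-Z ω) 0} = Z ⁻¹' Set.Iic (-t) := by
    ext ω
    simp [ht.not_ge, le_neg]
  have hXpos := integral_le_mul_integral_add_of_measureReal_le hX.pos_part hY.pos_part
    (fun _ => le_max_right _ _) (fun _ => le_max_right _ _) (Real.exp_nonneg ε) hM.le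
    (δ := δ) fun t ht => by
      rw [hpos X ht, hpos Y ht]
      exact hDP₁ _ measurableSet_Ici
  have hYneg := integral_le_mul_integral_add_of_measureReal_le hY.neg_part hX.neg_part
    (fun _ => le_max_right _ _) (fun _ => le_max_right _ _) (Real.exp_nonneg ε) hM.le
    (δ := δ) fun t ht => by
      rw [hneg X ht, hneg Y ht]
      exact hDP₂ _ measurableSet_Iic
  have htailX : ∫ t in Set.Ioi M, μ.real {ω | t ≤ max (X ω) 0}
      = ∫ t in Set.Ioi M, (μ {ω | t ≤ X ω}).toReal :=
    setIntegral_congr_fun measurableSet_Ioi fun t ht =>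
      congrArg μ.real (hpos X (hM.trans ht))
  have htailY : ∫ t in Set.Ioi M, μ.real {ω | t ≤ max (-Y ω) 0}
      = ∫ t in Set.Ioi M, (μ {ω | Y ω ≤ -t}).toReal :=
    setIntegral_congr_fun measurableSet_Ioi fun t ht =>
      congrArg μ.real (hneg Y (hM.trans ht))
  rw [htailX] at hXpos
  rw [htailY] at hYneg
  have htailY0 : 0 ≤ ∫ t in Set.Ioi M, (μ {ω | Y ω ≤ -t}).toReal :=
    integral_nonneg fun t => ENNReal.toReal_nonneg
  have hparts (Z : Ω → ℝ) (hZ : Integrable Z μ) :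
      ∫ ω, Z ω ∂μ = ∫ ω, max (Z ω) 0 ∂μ - ∫ ω, max (-Z ω) 0 ∂μ := by
    rw [← integral_sub hZ.pos_part hZ.neg_part]
    exact integral_congr_ae (ae_of_all _ fun ω => (max_zero_sub_max_neg_zero_eq_self (Z ω)).symm)
  have habs : ∫ ω, |Y ω| ∂μ = ∫ ω, max (Y ω) 0 ∂μ + ∫ ω, max (-Y ω) 0 ∂μ := by
    rw [← integral_add hY.pos_part hY.neg_part]
    exact integral_congr_ae
      (ae_of_all _ fun ω => (max_zero_add_max_neg_zero_eq_abs_self (Y ω)).symm)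
  have hYeq := hparts Y hY
  rw [hparts X hX, habs]
  have hY0 : 0 ≤ ∫ ω, max (Y ω) 0 ∂μ := integral_nonneg fun ω => le_max_right _ _
  have hYpn : ∫ ω, max (-Y ω) 0 ∂μ = ∫ ω, max (Y ω) 0 ∂μ := by linarith
  rw [hYpn] at hYneg ⊢
  set T := ∫ t in Set.Ioi M, (μ {ω | Y ω ≤ -t}).toReal
  set P := ∫ ω, max (Y ω) 0 ∂μ
  set N := ∫ ω, max (-X ω) 0 ∂μ
  have hexp : 1 ≤ Real.exp ε := Real.one_le_exp hε
  have hN : (2 - Real.exp ε) * P - M * δ - T ≤ N := by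
    have hMδ : 0 ≤ M * δ := mul_nonneg hM.le hδ0
    have hmul : Real.exp ε * ((2 - Real.exp ε) * P - M * δ - T) ≤ Real.exp ε * N := by
      nlinarith [mul_nonneg (sq_nonneg (Real.exp ε - 1)) hY0,
        mul_nonneg (sub_nonneg.2 hexp) (add_nonneg hMδ htailY0)]
    exact le_of_mul_le_mul_left hmul (Real.exp_pos ε)
  linarith
end
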